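/- Let U be a nonempty subset of V and define η̂ ∈ [0,∞)^U by η̂_i = η_i + Σ_{j∈V∖U} W_{ij}. Then the pushforward of ν_V^{W,η} under the restriction map β ↦ (β_i)_{i∈U} equals ν_U^{W_{U,U}, η̂}, where W_{U,U} = (W_{ij})_{i,j∈U}. -/

import Mathlib

open MeasureTheory Matrix

noncomputable section

/-- The Schrödinger operator `H_β = 2·diag(β) − W`. -/
def Hmat {V : Type*} [Fintype V] [DecidableEq V] (W : Matrix V V ℝ) (β : V → ℝ) :
    Matrix V V ℝ :=
  2 • Matrix.diagonal β - W

/-- Density of the measure `ν_V^{W,η}` with respect to Lebesgue measure. -/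
def nuDens {V : Type*} [Fintype V] [DecidableEq V] (W : Matrix V V ℝ) (η : V → ℝ)
    (β : V → ℝ) : ENNReal :=
  Set.indicator {β : V → ℝ | (Hmat W β).PosDef}
    (fun β => ENNReal.ofReal
      ((2 / Real.pi) ^ ((Fintype.card V : ℝ) / 2) *
        Real.exp (-(1 / 2) * ((1 : V → ℝ) ⬝ᵥ (Hmat W β).mulVec 1
            + η ⬝ᵥ (Hmat W β)⁻¹.mulVec η) + η ⬝ᵥ (1 : V → ℝ)) /
        Real.sqrt (Hmat W β).det)) β

/-- The measure `ν_V^{W,η}`. -/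
def nuMeas {V : Type*} [Fintype V] [DecidableEq V] (W : Matrix V V ℝ) (η : V → ℝ) :
    Measure (V → ℝ) :=
  volume.withDensity (nuDens W η)

/-- The graph on `V` with an edge `{i,j}` whenever `W i j > 0`. -/
def graphOf {V : Type*} (W : Matrix V V ℝ) : SimpleGraph V :=
  SimpleGraph.fromRel (fun i j => 0 < W i j)

open Set in
lemma aux_gauss : ∫⁻ u : ℝ, ENNReal.ofReal (Real.exp (-(1/2) * u^2)) = ENNReal.ofReal (Real.sqrt (2 * Real.pi)) := by
  rw [← ofReal_integral_eq_lintegral_ofReal (integrable_exp_neg_mul_sq (by norm_num))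
    (Filter.Eventually.of_forall fun _ => Real.exp_nonneg _), integral_gaussian]
  congr 2
  ring

open Set in
lemma aux_half_gauss : ∫⁻ u in Ioi (0:ℝ), ENNReal.ofReal (Real.exp (-(1/2) * u^2)) =
    ENNReal.ofReal (Real.sqrt (Real.pi / 2)) := by
  rw [← ofReal_integral_eq_lintegral_ofReal (integrable_exp_neg_mul_sq (by norm_num)).integrableOn
    (Filter.Eventually.of_forall fun _ => Real.exp_nonneg _), integral_gaussian_Ioi]
  congr 1
  rw [show Real.pi / (1/2) = 2^2 * (Real.pi / 2) by ring, Real.sqrt_mul (by positivity),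
    Real.sqrt_sq (by norm_num)]
  ring

open Set in
lemma aux_symm {c : ℝ} (hc : 0 < c) :
    ∫⁻ t in Ioi (0:ℝ), ENNReal.ofReal (Real.exp (-(1/2) * (t^2 + c^2/t^2))) =
    ∫⁻ t in Ioi (0:ℝ), ENNReal.ofReal (c/t^2 * Real.exp (-(1/2) * (t^2 + c^2/t^2))) := by
  have himg : (fun t : ℝ => c / t) '' Ioi 0 = Ioi 0 := by
    ext y
    constructor
    · rintro ⟨t, ht, rfl⟩
      exact div_pos hc ht
    · intro hy
      have hy' : (0:ℝ) < y := hy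
      exact ⟨c / y, div_pos hc hy, by field_simp⟩
  conv_lhs => rw [← himg]
  rw [lintegral_image_eq_lintegral_abs_deriv_mul measurableSet_Ioi (f' := fun t => - c / t^2)]
  · refine setLIntegral_congr_fun measurableSet_Ioi fun t ht => ?_
    have ht' : (0:ℝ) < t := ht
    rw [← ENNReal.ofReal_mul (abs_nonneg _)]
    congr 2
    · rw [abs_div, abs_neg, abs_of_pos hc, abs_of_pos (by positivity)]
    · congr 2
      field_simp
      ring
  · intro t ht
    have ht' : (0:ℝ) < t := ht
    have := (hasDerivAt_inv ht'.ne').const_mul c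
    refine HasDerivAt.hasDerivWithinAt ?_
    convert! this using 1
    field_simp
  · intro a ha b hb h
    have ha' : (0:ℝ) < a := ha
    have hb' : (0:ℝ) < b := hb
    simp only at h
    field_simp at h
    exact h.symm

open Set in
lemma aux_sub {c : ℝ} (hc : 0 < c) :
    ∫⁻ t in Ioi (0:ℝ), ENNReal.ofReal ((1 + c/t^2) * Real.exp (-(1/2) * (t^2 + c^2/t^2))) =
    ENNReal.ofReal (Real.exp (-c) * Real.sqrt (2 * Real.pi)) := by
  have himg : (fun t : ℝ => t - c / t) '' Ioi 0 = univ := by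
    ext y
    simp only [mem_image, mem_Ioi, mem_univ, iff_true]
    have h1 : |y| < Real.sqrt (y^2 + 4 * c) := by
      rw [← Real.sqrt_sq_eq_abs]
      exact Real.sqrt_lt_sqrt (sq_nonneg _) (by linarith)
    have h2 := neg_abs_le y
    have h3 : 0 < (y + Real.sqrt (y^2 + 4 * c)) / 2 := by linarith
    refine ⟨_, h3, ?_⟩
    have h4 : Real.sqrt (y^2 + 4 * c) ^ 2 = y^2 + 4*c := Real.sq_sqrt (by positivity)
    have h5 := h3.ne'
    generalize Real.sqrt (y^2 + 4 * c) = r at *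
    have h6 : y + r ≠ 0 := by intro h; simp [h] at h5
    field_simp
    nlinarith
  have key := lintegral_image_eq_lintegral_abs_deriv_mul (s := Ioi (0:ℝ))
    (f := fun t : ℝ => t - c / t) (f' := fun t => 1 + c / t^2) measurableSet_Ioi ?_ ?_
    (fun u => ENNReal.ofReal (Real.exp (-(1/2) * u^2)))
  · rw [himg, setLIntegral_univ, aux_gauss] at key
    rw [ENNReal.ofReal_mul (Real.exp_nonneg _), key, ← lintegral_const_mul' _ _ (by simp)]
    refine setLIntegral_congr_fun measurableSet_Ioi fun t ht => ?_
    have ht' : (0:ℝ) < t := ht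
    rw [← ENNReal.ofReal_mul (abs_nonneg _), ← ENNReal.ofReal_mul (Real.exp_nonneg _),
      abs_of_pos (by positivity), mul_left_comm, ← Real.exp_add]
    congr 3
    field_simp
    ring
  · intro t ht
    have ht' : (0:ℝ) < t := ht
    have := (hasDerivAt_id t).sub ((hasDerivAt_inv ht'.ne').const_mul c)
    refine HasDerivAt.hasDerivWithinAt ?_
    convert! this using 1
    field_simp
    ring
  · intro a ha b hb h
    have ha' : (0:ℝ) < a := ha
    have hb' : (0:ℝ) < b := hb
    simp only at h
    field_simp at h
    have : (a - b) * (a * b + c) = 0 := by nlinarith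
    rcases mul_eq_zero.1 this with h | h
    · linarith
    · nlinarith [mul_pos ha' hb']

open Set in
lemma aux_int {c : ℝ} (hc : 0 ≤ c) :
    ∫⁻ t in Ioi (0:ℝ), ENNReal.ofReal (Real.exp (-(1/2) * (t^2 + c^2/t^2))) =
    ENNReal.ofReal (Real.exp (-c) * Real.sqrt (Real.pi / 2)) := by
  rcases hc.eq_or_lt with rfl | hc
  · simpa using aux_half_gauss
  have h1 := aux_sub hc
  have h2 := aux_symm hc
  have h3 : ∫⁻ t in Ioi (0:ℝ), ENNReal.ofReal ((1 + c/t^2) * Real.exp (-(1/2) * (t^2 + c^2/t^2)))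
    = (∫⁻ t in Ioi (0:ℝ), ENNReal.ofReal (Real.exp (-(1/2) * (t^2 + c^2/t^2)))) +
     ∫⁻ t in Ioi (0:ℝ), ENNReal.ofReal (c/t^2 * Real.exp (-(1/2) * (t^2 + c^2/t^2))) := by
    rw [← lintegral_add_left (by fun_prop)]
    refine lintegral_congr fun t => ?_
    rw [← ENNReal.ofReal_add (by positivity) (by positivity)]
    congr 1
    ring
  rw [h3, ← h2, ← two_mul] at h1
  have h4 : Real.exp (-c) * Real.sqrt (2 * Real.pi) = 2 * (Real.exp (-c) * Real.sqrt (Real.pi / 2)) := by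
    rw [show 2 * Real.pi = 2^2 * (Real.pi / 2) by ring, Real.sqrt_mul (by positivity),
      Real.sqrt_sq (by norm_num)]
    ring
  rw [h4, ENNReal.ofReal_mul (by norm_num), ENNReal.ofReal_ofNat] at h1
  exact (ENNReal.mul_right_inj (by simp) (by simp)).1 h1

open Set in
lemma aux_int_b {c : ℝ} (hc : 0 ≤ c) (q : ℝ) :
    ∫⁻ b in {b : ℝ | 0 < 2 * b - q}, ENNReal.ofReal
      (Real.exp (-(1/2) * ((2 * b - q) + c^2/(2 * b - q))) / Real.sqrt (2 * b - q)) =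
    ENNReal.ofReal (Real.exp (-c) * Real.sqrt (Real.pi / 2)) := by
  have himg : (fun t : ℝ => (t^2 + q) / 2) '' Ioi 0 = {b : ℝ | 0 < 2 * b - q} := by
    ext y
    constructor
    · rintro ⟨t, ht, rfl⟩
      have ht' : (0:ℝ) < t := ht
      simp only [mem_ofPred_eq]
      nlinarith [pow_pos ht' 2]
    · intro hy
      have hy' : (0:ℝ) < 2 * y - q := hy
      refine ⟨Real.sqrt (2 * y - q), Real.sqrt_pos.2 hy', ?_⟩
      simp only [Real.sq_sqrt hy'.le]
      ring
  rw [← himg, lintegral_image_eq_lintegral_abs_deriv_mul measurableSet_Ioi (f' := fun t => t),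
    ← aux_int hc]
  · refine setLIntegral_congr_fun measurableSet_Ioi fun t ht => ?_
    have ht' : (0:ℝ) < t := ht
    rw [← ENNReal.ofReal_mul (abs_nonneg _), show 2 * ((t^2+q)/2) - q = t^2 by ring,
      Real.sqrt_sq ht'.le, abs_of_pos ht']
    congr 1
    field_simp
  · intro t ht
    refine HasDerivAt.hasDerivWithinAt ?_
    convert! (((hasDerivAt_id t).pow 2).add_const q).div_const 2 using 1
    simp
  · intro a ha b hb h
    have ha' : (0:ℝ) < a := ha
    have hb' : (0:ℝ) < b := hb
    simp only at h
    exact (sq_eq_sq₀ ha'.le hb'.le).1 (by linarith)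

lemma aux_inv_nonneg {ι : Type*} [Fintype ι] [DecidableEq ι] {A : Matrix ι ι ℝ} (hA : A.PosDef)
    (off : ∀ i j, i ≠ j → A i j ≤ 0) {η : ι → ℝ} (hη : ∀ i, 0 ≤ η i) (i : ι) :
    0 ≤ (A⁻¹ *ᵥ η) i := by
  have hdet : IsUnit A.det := (A.isUnit_iff_isUnit_det).1 hA.isUnit
  set x := A⁻¹ *ᵥ η with hx
  have hAx : A *ᵥ x = η := by
    rw [hx, Matrix.mulVec_mulVec, Matrix.mul_nonsing_inv _ hdet, Matrix.one_mulVec]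
  set n : ι → ℝ := fun i => max (-x i) 0 with hn
  have hn0 : ∀ i, 0 ≤ n i := fun i => le_max_right _ _
  have hnx : ∀ i, - x i ≤ n i := fun i => le_max_left _ _
  have hnn : ∀ i, n i * x i = - (n i * n i) := by
    intro i
    rcases max_cases (-x i) 0 with h | h
    · rw [show n i = - x i from h.1]; ring
    · rw [show n i = 0 from h.1]; ring
  have h1 : 0 ≤ n ⬝ᵥ (A *ᵥ x) := by
    rw [hAx]
    exact Finset.sum_nonneg fun i _ => mul_nonneg (hn0 i) (hη i)
  have h2 : n ⬝ᵥ (A *ᵥ x) ≤ - (n ⬝ᵥ (A *ᵥ n)) := by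
    simp only [dotProduct, Matrix.mulVec, Finset.mul_sum, ← Finset.sum_neg_distrib]
    refine Finset.sum_le_sum fun i _ => Finset.sum_le_sum fun j _ => ?_
    by_cases hij : i = j
    · subst hij
      have := hnn i
      apply le_of_eq
      linear_combination (A i i) * this
    · have h3 := mul_nonneg (mul_nonneg (neg_nonneg.2 (off i j hij)) (hn0 i))
        (by linarith [hnx j] : 0 ≤ n j + x j)
      nlinarith
  have h3 : n = 0 := by
    by_contra hne
    have := hA.dotProduct_mulVec_pos hne
    simp only [star_trivial] at this
    linarith
  have := hnx i
  rw [h3] at this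
  simp only [Pi.zero_apply] at this
  linarith

/-- Block matrix. -/
def blk {ι : Type*} (A : Matrix ι ι ℝ) (w : ι → ℝ) (d : ℝ) : Matrix (ι ⊕ Unit) (ι ⊕ Unit) ℝ :=
  Matrix.fromBlocks A (Matrix.of fun i _ => - w i) (Matrix.of fun i _ => - w i)ᴴ
    (Matrix.of fun _ _ => d)

lemma aux_schur {ι : Type*} [Fintype ι] [DecidableEq ι] (A : Matrix ι ι ℝ)
    (w : ι → ℝ) (d : ℝ) :
    (Matrix.of fun _ _ => d) - (Matrix.of fun i (_ : Unit) => - w i)ᴴ * A⁻¹ *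
      (Matrix.of fun i (_ : Unit) => - w i) = Matrix.of fun _ _ => d - w ⬝ᵥ (A⁻¹ *ᵥ w) := by
  ext a b
  rw [Matrix.mul_assoc]
  simp [Matrix.mul_apply, dotProduct, Matrix.mulVec, Finset.mul_sum]

lemma aux_blk_det {ι : Type*} [Fintype ι] [DecidableEq ι] {A : Matrix ι ι ℝ} (hA : A.PosDef)
    (w : ι → ℝ) (d : ℝ) : (blk A w d).det = A.det * (d - w ⬝ᵥ (A⁻¹ *ᵥ w)) := by
  have := hA.isUnit.invertible
  rw [blk, Matrix.det_fromBlocks₁₁, Matrix.invOf_eq_nonsing_inv, aux_schur,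
    Matrix.det_unique (n := Unit)]
  rfl

lemma aux_blk_posDef {ι : Type*} [Fintype ι] [DecidableEq ι] {A : Matrix ι ι ℝ} (hA : A.PosDef)
    (w : ι → ℝ) (d : ℝ) : (blk A w d).PosDef ↔ 0 < d - w ⬝ᵥ (A⁻¹ *ᵥ w) := by
  have := hA.isUnit.invertible
  constructor
  · intro h
    have h1 := h.det_pos
    rw [aux_blk_det hA] at h1
    exact (pos_iff_pos_of_mul_pos h1).1 hA.det_pos
  · intro h
    have h1 : (blk A w d).PosSemidef := by
      rw [blk, Matrix.PosDef.fromBlocks₁₁ _ _ hA, aux_schur]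
      refine .of_dotProduct_mulVec_nonneg ?_ fun x => ?_
      · ext; simp
      · simp only [dotProduct, Matrix.mulVec, star_trivial, Finset.univ_unique,
          Finset.sum_singleton, Matrix.of_apply]
        have h2 := mul_nonneg h.le (mul_self_nonneg (x default))
        simp only [dotProduct, Matrix.mulVec] at h2
        linarith
    rw [h1.posDef_iff_det_ne_zero, aux_blk_det hA]
    exact mul_ne_zero hA.det_pos.ne' h.ne'

lemma aux_symm_dot {ι : Type*} [Fintype ι] {A : Matrix ι ι ℝ} (hA : A.IsHermitian) (x y : ι → ℝ) :
    x ⬝ᵥ (A *ᵥ y) = y ⬝ᵥ (A *ᵥ x) := by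
  rw [Matrix.dotProduct_mulVec, dotProduct_comm, ← Matrix.mulVec_transpose]
  have := hA.eq
  rw [Matrix.conjTranspose_eq_transpose_of_trivial] at this
  rw [this]

lemma aux_blk_quad {ι : Type*} [Fintype ι] [DecidableEq ι] {A : Matrix ι ι ℝ} (hA : A.PosDef)
    (w : ι → ℝ) (d : ℝ) (hs : 0 < d - w ⬝ᵥ (A⁻¹ *ᵥ w)) (η : ι ⊕ Unit → ℝ) :
    η ⬝ᵥ ((blk A w d)⁻¹ *ᵥ η) = (η ∘ Sum.inl) ⬝ᵥ (A⁻¹ *ᵥ (η ∘ Sum.inl)) +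
      (η (Sum.inr ()) + w ⬝ᵥ (A⁻¹ *ᵥ (η ∘ Sum.inl)))^2 / (d - w ⬝ᵥ (A⁻¹ *ᵥ w)) := by
  have hdet : IsUnit A.det := (A.isUnit_iff_isUnit_det).1 hA.isUnit
  have hdetB : IsUnit (blk A w d).det :=
    (Matrix.isUnit_iff_isUnit_det _).1 ((aux_blk_posDef hA w d).2 hs).isUnit
  set s := d - w ⬝ᵥ (A⁻¹ *ᵥ w) with hsdef
  set η1 := η ∘ Sum.inl with hη1
  set y := A⁻¹ *ᵥ η1 with hy
  set c := η (Sum.inr ()) + w ⬝ᵥ y with hc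
  set v := A⁻¹ *ᵥ w with hv
  have hAy : A *ᵥ y = η1 := by
    rw [hy, Matrix.mulVec_mulVec, Matrix.mul_nonsing_inv _ hdet, Matrix.one_mulVec]
  have hAv : A *ᵥ v = w := by
    rw [hv, Matrix.mulVec_mulVec, Matrix.mul_nonsing_inv _ hdet, Matrix.one_mulVec]
  have hsym : η1 ⬝ᵥ v = w ⬝ᵥ y := aux_symm_dot hA.inv.isHermitian _ _
  set x : ι ⊕ Unit → ℝ := Sum.elim (y + (c / s) • v) (fun _ => c / s) with hx
  have hBx : blk A w d *ᵥ x = η := by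
    rw [blk, Matrix.fromBlocks_mulVec]
    ext i
    rcases i with i | i
    · have h1 : x ∘ Sum.inl = y + (c / s) • v := rfl
      rw [Sum.elim_inl, h1, Matrix.mulVec_add, Matrix.mulVec_smul, hAy, hAv]
      simp only [Pi.add_apply, Pi.smul_apply, Matrix.mulVec, dotProduct, Finset.univ_unique,
        Finset.sum_singleton, Matrix.of_apply, Function.comp, hx, Sum.elim_inr, hη1, smul_eq_mul]
      ring
    · have h1 : x ∘ Sum.inl = y + (c / s) • v := rfl
      rw [Sum.elim_inr, h1]
      have h2 : ((Matrix.of fun i (_ : Unit) => - w i)ᴴ *ᵥ (y + (c / s) • v)) i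
          = - (w ⬝ᵥ (y + (c / s) • v)) := by
        simp [Matrix.mulVec, dotProduct]
      rw [Pi.add_apply, h2, dotProduct_add, dotProduct_smul]
      simp only [Matrix.mulVec, dotProduct, Finset.univ_unique,
        Finset.sum_singleton, Matrix.of_apply, Function.comp, hx, Sum.elim_inr, smul_eq_mul]
      have h3 : w ⬝ᵥ v = d - s := by rw [hsdef]; ring
      have h4 : w ⬝ᵥ y = c - η (Sum.inr ()) := by rw [hc]; ring
      simp only [dotProduct] at h3 h4
      rw [h3, h4]
      field_simp
      ring
  have hinv : (blk A w d)⁻¹ *ᵥ η = x := by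
    rw [← hBx, Matrix.mulVec_mulVec, Matrix.nonsing_inv_mul _ hdetB, Matrix.one_mulVec]
  rw [hinv]
  have : η ⬝ᵥ x = η1 ⬝ᵥ (y + (c / s) • v) + η (Sum.inr ()) * (c / s) := by
    simp [dotProduct, hx, hη1]
  rw [this, dotProduct_add, dotProduct_smul, hsym, smul_eq_mul]
  have h4 : w ⬝ᵥ y = c - η (Sum.inr ()) := by rw [hc]; ring
  rw [h4]
  field_simp
  ring

lemma aux_blk_one {ι : Type*} [Fintype ι] (A : Matrix ι ι ℝ)
    (w : ι → ℝ) (d : ℝ) :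
    (1 : ι ⊕ Unit → ℝ) ⬝ᵥ (blk A w d *ᵥ 1) = 1 ⬝ᵥ (A *ᵥ 1) - 2 * (w ⬝ᵥ 1) + d := by
  rw [blk, Matrix.fromBlocks_mulVec]
  simp [dotProduct, Matrix.mulVec, Finset.sum_add_distrib]
  ring

lemma Hmat_apply {ι : Type*} [Fintype ι] [DecidableEq ι] (W : Matrix ι ι ℝ) (β : ι → ℝ) (i j : ι) :
    Hmat W β i j = 2 * (if i = j then β i else 0) - W i j := by
  rw [Hmat, Matrix.sub_apply, Matrix.smul_apply, Matrix.diagonal_apply, nsmul_eq_mul]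
  norm_num

lemma aux_Hmat_blk {ι : Type*} [Fintype ι] [DecidableEq ι] (W : Matrix (ι ⊕ Unit) (ι ⊕ Unit) ℝ)
    (hW : W.IsSymm) (a : ι → ℝ) (b : Unit → ℝ) :
    Hmat W (Sum.elim a b) = blk (Hmat (Matrix.of fun i j => W (Sum.inl i) (Sum.inl j)) a)
      (fun i => W (Sum.inl i) (Sum.inr ())) (2 * b () - W (Sum.inr ()) (Sum.inr ())) := by
  ext i j
  rcases i with i | i <;> rcases j with j | j
  · simp [Hmat_apply, blk]
  · simp [Hmat_apply, blk]
  · simp [Hmat_apply, blk, hW.apply]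
  · simp [Hmat_apply, blk]

lemma nuDens_pos {ι : Type*} [Fintype ι] [DecidableEq ι] (W : Matrix ι ι ℝ) (η β : ι → ℝ)
    (h : (Hmat W β).PosDef) : nuDens W η β = ENNReal.ofReal
      ((2 / Real.pi) ^ ((Fintype.card ι : ℝ) / 2) *
        Real.exp (-(1 / 2) * ((1 : ι → ℝ) ⬝ᵥ (Hmat W β).mulVec 1
            + η ⬝ᵥ (Hmat W β)⁻¹.mulVec η) + η ⬝ᵥ (1 : ι → ℝ)) /
        Real.sqrt (Hmat W β).det) := by
  have h' : β ∈ {β : ι → ℝ | (Hmat W β).PosDef} := h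
  rw [nuDens, Set.indicator_of_mem h']

lemma nuDens_neg {ι : Type*} [Fintype ι] [DecidableEq ι] (W : Matrix ι ι ℝ) (η β : ι → ℝ)
    (h : ¬ (Hmat W β).PosDef) : nuDens W η β = 0 := by
  have h' : β ∉ {β : ι → ℝ | (Hmat W β).PosDef} := h
  rw [nuDens, Set.indicator_of_notMem h']

lemma aux_Hmat_cont {ι : Type*} [Fintype ι] [DecidableEq ι] (W : Matrix ι ι ℝ) :
    Continuous (Hmat W) := by
  unfold Hmat
  fun_prop

lemma aux_meas_posDef {ι : Type*} [Fintype ι] [DecidableEq ι] (W : Matrix ι ι ℝ) :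
    MeasurableSet {β : ι → ℝ | (Hmat W β).PosDef} := by
  have hc := aux_Hmat_cont W
  have h : {β : ι → ℝ | (Hmat W β).PosDef} =
      ({β | (Hmat W β)ᴴ = Hmat W β} ∩ ⋂ x : ι → ℝ, {β | 0 ≤ x ⬝ᵥ (Hmat W β *ᵥ x)}) ∩
        {β | (Hmat W β).det = 0}ᶜ := by
    ext β
    simp only [Set.mem_inter_iff, Set.mem_iInter, Set.mem_compl_iff, Set.mem_ofPred_eq]
    constructor
    · intro h
      exact ⟨⟨h.isHermitian, fun x => by simpa using h.posSemidef.dotProduct_mulVec_nonneg x⟩,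
        h.det_pos.ne'⟩
    · rintro ⟨⟨h1, h2⟩, h3⟩
      have : (Hmat W β).PosSemidef := .of_dotProduct_mulVec_nonneg h1 (by simpa using h2)
      exact this.posDef_iff_det_ne_zero.2 h3
  rw [h]
  refine MeasurableSet.inter (IsClosed.measurableSet (IsClosed.inter ?_ ?_)) ?_
  · exact isClosed_eq hc.matrix_conjTranspose hc
  · refine isClosed_iInter fun x => isClosed_le continuous_const ?_
    exact Continuous.dotProduct continuous_const (hc.matrix_mulVec continuous_const)
  · exact (isClosed_eq hc.matrix_det continuous_const).measurableSet.compl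

lemma aux_meas_nuDens {ι : Type*} [Fintype ι] [DecidableEq ι] (W : Matrix ι ι ℝ) (η : ι → ℝ) :
    Measurable (nuDens W η) := by
  have hc := aux_Hmat_cont W
  unfold nuDens
  refine Measurable.indicator ?_ (aux_meas_posDef W)
  have h1 : Measurable fun β => (1 : ι → ℝ) ⬝ᵥ (Hmat W β) *ᵥ 1 :=
    (Continuous.dotProduct continuous_const (hc.matrix_mulVec continuous_const)).measurable
  have h2 : Measurable fun β => η ⬝ᵥ (Hmat W β)⁻¹ *ᵥ η := by
    have : (fun β => η ⬝ᵥ (Hmat W β)⁻¹ *ᵥ η) =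
      fun β => ((Hmat W β).det)⁻¹ * (η ⬝ᵥ (Hmat W β).adjugate *ᵥ η) := by
      ext β
      rw [Matrix.inv_def, Matrix.smul_mulVec, dotProduct_smul, Ring.inverse_eq_inv, smul_eq_mul]
    rw [this]
    exact hc.matrix_det.measurable.inv.mul
      (Continuous.dotProduct continuous_const
        (hc.matrix_adjugate.matrix_mulVec continuous_const)).measurable
  have h3 : Measurable fun β => (Hmat W β).det := hc.matrix_det.measurable
  fun_prop

lemma aux_transport {ι κ : Type*} [Fintype ι] [DecidableEq ι] [Fintype κ] [DecidableEq κ]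
    (e : ι ≃ κ) (W : Matrix κ κ ℝ) (η : κ → ℝ) :
    Measure.map (fun (β : κ → ℝ) i => β (e i)) (nuMeas W η) =
      nuMeas (W.submatrix e e) (fun i => η (e i)) := by
  have hd : ∀ β : κ → ℝ, nuDens (W.submatrix e e) (fun i => η (e i)) (fun i => β (e i)) =
      nuDens W η β := by
    intro β
    have hH : Hmat (W.submatrix e e) (fun i => β (e i)) = (Hmat W β).submatrix e e := by
      ext i j
      simp [Hmat_apply]
    have hpd : (Hmat (W.submatrix e e) (fun i => β (e i))).PosDef ↔ (Hmat W β).PosDef := by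
      rw [hH]
      constructor
      · intro h
        have := h.submatrix e.symm.injective
        simpa using this
      · intro h
        exact h.submatrix e.injective
    have hq : ∀ (M : Matrix κ κ ℝ) (v : κ → ℝ), (fun i => v (e i)) ⬝ᵥ
        ((M.submatrix e e) *ᵥ (fun i => v (e i))) = v ⬝ᵥ (M *ᵥ v) := by
      intro M v
      simp only [dotProduct, Matrix.mulVec, Matrix.submatrix_apply]
      rw [← e.sum_comp]
      refine Finset.sum_congr rfl fun i _ => ?_
      rw [← e.sum_comp (fun j => M (e i) j * v j)]
    by_cases h : (Hmat W β).PosDef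
    · rw [nuDens_pos _ _ _ (hpd.2 h), nuDens_pos _ _ _ h]
      have h1 := hq (Hmat W β) 1
      have h2 := hq (Hmat W β)⁻¹ η
      have h3 : (fun i => η (e i)) ⬝ᵥ (1 : ι → ℝ) = η ⬝ᵥ 1 := by
        simp only [dotProduct, Pi.one_apply, mul_one]
        exact e.sum_comp η
      rw [hH, Matrix.inv_submatrix_equiv, h2, h3, Matrix.det_submatrix_equiv_self,
        Fintype.card_congr e]
      have h4 : (fun i => (1 : κ → ℝ) (e i)) = 1 := rfl
      rw [h4] at h1
      rw [h1]
    · rw [nuDens_neg _ _ _ (fun h' => h (hpd.1 h')), nuDens_neg _ _ _ h]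
  have hmp : MeasurePreserving (fun (β : κ → ℝ) i => β (e i)) volume volume := by
    convert! volume_measurePreserving_piCongrLeft (fun _ : ι => ℝ) e.symm using 1
    ext β i
    have := Equiv.piCongrLeft_apply_apply (fun _ : ι => ℝ) e.symm β (e i)
    simp only [Equiv.symm_apply_apply] at this
    exact this.symm
  ext s hs
  rw [Measure.map_apply hmp.measurable hs, nuMeas, nuMeas, withDensity_apply _ hs,
    withDensity_apply _ (hmp.measurable hs),
    ← hmp.setLIntegral_comp_preimage hs (aux_meas_nuDens _ _)]
  simp only [hd]

lemma aux_inner {ι : Type*} [Fintype ι] [DecidableEq ι] (W : Matrix (ι ⊕ Unit) (ι ⊕ Unit) ℝ)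
    (hW : W.IsSymm) (hnn : ∀ i j, 0 ≤ W i j) (η : ι ⊕ Unit → ℝ) (hη : ∀ i, 0 ≤ η i) (a : ι → ℝ) :
    ∫⁻ b : Unit → ℝ, nuDens W η (Sum.elim a b) =
      nuDens (Matrix.of fun i j => W (Sum.inl i) (Sum.inl j))
        (fun i => η (Sum.inl i) + W (Sum.inl i) (Sum.inr ())) a := by
  rw [← ((volume_preserving_funUnique Unit ℝ).symm _).lintegral_comp_emb
    (MeasurableEquiv.measurableEmbedding _)]
  have hsymm : ∀ x : ℝ, (MeasurableEquiv.funUnique Unit ℝ).symm x = fun _ => x := fun x => rfl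
  simp only [hsymm]
  by_cases hA : (Hmat (Matrix.of fun i j => W (Sum.inl i) (Sum.inl j)) a).PosDef
  swap
  · have : ∀ x : ℝ, nuDens W η (Sum.elim a fun _ => x) = 0 := by
      intro x
      refine nuDens_neg _ _ _ (fun h' => hA ?_)
      have := h'.submatrix (Sum.inl_injective (α := ι) (β := Unit))
      rw [aux_Hmat_blk W hW] at this
      exact this
    simp only [this, lintegral_zero]
    exact (nuDens_neg _ _ _ hA).symm
  set A := Hmat (Matrix.of fun i j => W (Sum.inl i) (Sum.inl j)) a with hAdef
  set w : ι → ℝ := fun i => W (Sum.inl i) (Sum.inr ()) with hw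
  set η1 : ι → ℝ := η ∘ Sum.inl with hη1
  set c := η (Sum.inr ()) + w ⬝ᵥ (A⁻¹ *ᵥ η1) with hc
  have hc0 : 0 ≤ c := by
    refine add_nonneg (hη _) (Finset.sum_nonneg fun i _ => mul_nonneg (hnn _ _) ?_)
    refine aux_inv_nonneg hA ?_ (fun i => hη _) i
    intro i j hij
    rw [hAdef, Hmat_apply, if_neg hij]
    simpa using hnn _ _
  set q := W (Sum.inr ()) (Sum.inr ()) + w ⬝ᵥ (A⁻¹ *ᵥ w) with hq
  set K : ℝ := (2 / Real.pi) ^ (((Fintype.card ι : ℝ) + 1) / 2) *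
    Real.exp (-(1/2) * (1 ⬝ᵥ (A *ᵥ 1) - 2 * (w ⬝ᵥ 1) + w ⬝ᵥ (A⁻¹ *ᵥ w) + η1 ⬝ᵥ (A⁻¹ *ᵥ η1)) +
      η ⬝ᵥ 1) / Real.sqrt A.det with hK
  have hK0 : 0 ≤ K := by positivity
  have hdens : ∀ x : ℝ, nuDens W η (Sum.elim a fun _ => x) =
      Set.indicator {b : ℝ | 0 < 2 * b - q} (fun b => ENNReal.ofReal K * ENNReal.ofReal
      (Real.exp (-(1/2) * ((2 * b - q) + c^2/(2 * b - q))) / Real.sqrt (2 * b - q))) x := by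
    intro x
    have hB := aux_Hmat_blk W hW a (fun _ => x)
    rw [← hAdef, ← hw] at hB
    set d := 2 * x - W (Sum.inr ()) (Sum.inr ()) with hd
    have hs : d - w ⬝ᵥ (A⁻¹ *ᵥ w) = 2 * x - q := by rw [hd, hq]; ring
    have hpd := aux_blk_posDef hA w d
    rw [← hB, hs] at hpd
    by_cases h : 0 < 2 * x - q
    · have h' : x ∈ {b : ℝ | 0 < 2 * b - q} := h
      rw [nuDens_pos _ _ _ (hpd.2 h), Set.indicator_of_mem h', ← ENNReal.ofReal_mul hK0]
      congr 1
      rw [hB, aux_blk_one, aux_blk_quad hA w d (by rw [hs]; exact h), aux_blk_det hA, hs,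
        Real.sqrt_mul hA.det_pos.le, ← hη1, ← hc, hK, div_mul_div_comm, mul_assoc _ (Real.exp _),
        ← Real.exp_add]
      congr 2
      · congr 1
        simp
      · congr 1
        have : d = (2 * x - q) + w ⬝ᵥ (A⁻¹ *ᵥ w) := by rw [← hs]; ring
        rw [this]
        ring
    · have h'' : x ∉ {b : ℝ | 0 < 2 * b - q} := h
      rw [nuDens_neg _ _ _ (fun h' => h (hpd.1 h')), Set.indicator_of_notMem h'']
  simp only [hdens]
  have hms : MeasurableSet {b : ℝ | 0 < 2 * b - q} :=
    measurableSet_lt measurable_const (by fun_prop)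
  rw [lintegral_indicator hms, lintegral_const_mul' _ _ (by simp), aux_int_b hc0,
    ← ENNReal.ofReal_mul hK0, nuDens_pos _ _ _ hA, ← hAdef]
  congr 1
  have hpi : (2 / Real.pi) ^ (((Fintype.card ι : ℝ) + 1) / 2) * Real.sqrt (Real.pi / 2) =
      (2 / Real.pi) ^ ((Fintype.card ι : ℝ) / 2) := by
    rw [add_div, Real.rpow_add (by positivity), ← Real.sqrt_eq_rpow, mul_assoc,
      ← Real.sqrt_mul (by positivity)]
    rw [show 2 / Real.pi * (Real.pi / 2) = 1 by field_simp]
    simp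
  have hv : (fun i => η (Sum.inl i) + w i) = η1 + w := rfl
  rw [hv, Matrix.mulVec_add, dotProduct_add, add_dotProduct, add_dotProduct, add_dotProduct,
    aux_symm_dot hA.inv.isHermitian η1 w, ← hpi, hK]
  have h1 : η ⬝ᵥ 1 = η1 ⬝ᵥ 1 + η (Sum.inr ()) := by
    simp [dotProduct, hη1]
  rw [h1]
  have hexp : ∀ P E s e r E' : ℝ, E' = Real.exp (E + -c) →
      P * Real.exp E / s * (Real.exp (-c) * r) = P * r * E' / s := by
    intro P E s e r E' h
    rw [h, Real.exp_add]
    ring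
  apply hexp _ _ _ 0
  congr 1
  rw [hc]
  ring

lemma aux_step {ι : Type*} [Fintype ι] [DecidableEq ι] (W : Matrix (ι ⊕ Unit) (ι ⊕ Unit) ℝ)
    (hW : W.IsSymm) (hnn : ∀ i j, 0 ≤ W i j) (η : ι ⊕ Unit → ℝ) (hη : ∀ i, 0 ≤ η i) :
    Measure.map (fun (β : ι ⊕ Unit → ℝ) i => β (Sum.inl i)) (nuMeas W η) =
      nuMeas (Matrix.of fun i j => W (Sum.inl i) (Sum.inl j))
        (fun i => η (Sum.inl i) + W (Sum.inl i) (Sum.inr ())) := by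
  have hm : Measurable (fun (β : ι ⊕ Unit → ℝ) i => β (Sum.inl i)) := by fun_prop
  ext s hs
  rw [Measure.map_apply hm hs, nuMeas, nuMeas, withDensity_apply _ hs,
    withDensity_apply _ (hm hs)]
  have hmp := volume_measurePreserving_sumPiEquivProdPi_symm (fun _ : ι ⊕ Unit => ℝ)
  rw [← hmp.setLIntegral_comp_preimage (hm hs) (aux_meas_nuDens _ _)]
  have hpre : (MeasurableEquiv.sumPiEquivProdPi (fun _ : ι ⊕ Unit => ℝ)).symm ⁻¹'
    ((fun (β : ι ⊕ Unit → ℝ) i => β (Sum.inl i)) ⁻¹' s) = s ×ˢ Set.univ := by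
    ext p
    simp only [Set.mem_preimage, Set.mem_prod, Set.mem_univ, and_true]
    rfl
  have hcoe : ∀ p, (MeasurableEquiv.sumPiEquivProdPi (fun _ : ι ⊕ Unit => ℝ)).symm p =
      Sum.elim p.1 p.2 := by
    intro p
    ext i
    rcases i with i | i <;> rfl
  rw [hpre, Measure.volume_eq_prod, setLIntegral_prod]
  · refine setLIntegral_congr_fun hs fun a _ => ?_
    rw [setLIntegral_univ, ← aux_inner W hW hnn η hη]
    simp only [hcoe]
  · exact ((aux_meas_nuDens W η).comp (MeasurableEquiv.measurable _)).aemeasurable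

lemma aux_main {V : Type*} [Fintype V] [DecidableEq V]
    (W : Matrix V V ℝ) (hsymm : W.IsSymm) (hnn : ∀ i j, 0 ≤ W i j)
    (η : V → ℝ) (hη : ∀ i, 0 ≤ η i) (n : ℕ) : ∀ U : Finset V, Uᶜ.card = n →
    Measure.map (fun (β : V → ℝ) (i : ↥U) => β i.1) (nuMeas W η)
      = nuMeas (Matrix.of fun i j : ↥U => W i.1 j.1)
          (fun i : ↥U => η i.1 + ∑ j ∈ Uᶜ, W i.1 j) := by
  induction n with
  | zero =>
    intro U hU
    rw [Finset.card_eq_zero, Finset.compl_eq_empty_iff] at hU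
    subst hU
    have := aux_transport (Equiv.subtypeUnivEquiv (p := fun x => x ∈ (Finset.univ : Finset V))
      Finset.mem_univ) W η
    simp only [Finset.compl_univ, Finset.sum_empty, add_zero]
    convert! this using 1
  | succ n ih =>
    intro U hU
    obtain ⟨k, hk⟩ : Uᶜ.Nonempty := by
      rw [← Finset.card_pos]; omega
    have hkU : k ∉ U := Finset.mem_compl.1 hk
    have hcard : (insert k U)ᶜ.card = n := by
      rw [Finset.compl_insert, Finset.card_erase_of_mem hk]; omega
    have h1 := ih (insert k U) hcard
    let e : ↥U ⊕ Unit ≃ ↥(insert k U) :=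
      ((Finset.subtypeInsertEquivOption hkU).trans (Equiv.optionEquivSumPUnit _)).symm
    have he1 : ∀ i : ↥U, (e (Sum.inl i)).1 = i.1 := fun i => rfl
    have he2 : (e (Sum.inr ())).1 = k := rfl
    have h2 := aux_transport e (Matrix.of fun i j : ↥(insert k U) => W i.1 j.1)
          (fun i : ↥(insert k U) => η i.1 + ∑ j ∈ (insert k U)ᶜ, W i.1 j)
    have h3 := aux_step ((Matrix.of fun i j : ↥(insert k U) => W i.1 j.1).submatrix e e)
      (by ext i j; exact hsymm.apply _ _) (fun i j => hnn _ _)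
      (fun i => η (e i).1 + ∑ j ∈ (insert k U)ᶜ, W (e i).1 j)
      (fun i => add_nonneg (hη _) (Finset.sum_nonneg fun j _ => hnn _ _))
    rw [← h2, ← h1, Measure.map_map (by fun_prop) (by fun_prop),
      Measure.map_map (by fun_prop) (by fun_prop)] at h3
    have hη' : (fun i : ↥U => η i.1 + ∑ j ∈ Uᶜ, W i.1 j) = fun i : ↥U =>
        (η (e (Sum.inl i)).1 + ∑ j ∈ (insert k U)ᶜ, W (e (Sum.inl i)).1 j) +
        ((Matrix.of fun i j : ↥(insert k U) => W i.1 j.1).submatrix e e)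
          (Sum.inl i) (Sum.inr ()) := by
      ext i
      rw [Matrix.submatrix_apply, Matrix.of_apply, he1, he2, Finset.compl_insert,
        ← Finset.sum_erase_add _ _ hk]
      ring
    rw [hη']
    exact h3

theorem stmt3 {V : Type*} [Fintype V] [DecidableEq V] [Nonempty V]
    (W : Matrix V V ℝ) (hsymm : W.IsSymm) (hnn : ∀ i j, 0 ≤ W i j)
    (hdiag : ∀ i, W i i = 0) (hconn : (graphOf W).Connected)
    (η : V → ℝ) (hη : ∀ i, 0 ≤ η i)
    (U : Finset V) (hU : U.Nonempty) :
    Measure.map (fun (β : V → ℝ) (i : ↥U) => β i.1) (nuMeas W η)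
      = nuMeas (Matrix.of fun i j : ↥U => W i.1 j.1)
          (fun i : ↥U => η i.1 + ∑ j ∈ Uᶜ, W i.1 j) := by
  exact aux_main W hsymm hnn η hη _ U rfl

end
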